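/- arXiv:2312.17500 — 4 statements merged into one kernel-verified Lean document; each statement's English description precedes it below -/
import Mathlib

section
/- Fix q ∈ ℂ^×, complex numbers ξ_1,…,ξ_m, and polynomials s_1,…,s_m ∈ ℂ[z]. Let i_1 < … < i_{j−1} < a < b be indices in {1,…,m}. Then the quantum Wronskians satisfy the QQ-type (Desnanot–Jacobi) identity ξ_b · D_{i_1,…,i_{j−1},a}(z) · D_{i_1,…,i_{j−1},b}(qz) − ξ_a · D_{i_1,…,i_{j−1},a}(qz) · D_{i_1,…,i_{j−1},b}(z) = D_{i_1,…,i_{j−1},a,b}(z) · D_{i_1,…,i_{j−1}}(qz), as an identity of polynomials in z. -/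
open Finset Matrix Polynomial

/-- The quantum Wronskian `D_{v 1, …, v k}(z)` of the sections `s_i`: the determinant of the
`k×k` matrix whose `(a,b)`-entry is `ξ_{v a}^{b−1} s_{v a}(q^{b−1} z)`, as a polynomial in `z`.
(For `k = 0` this is `D_∅ = 1`.) -/
noncomputable def qWronsk {m : ℕ} (q : ℂ) (ξ : Fin m → ℂ) (s : Fin m → Polynomial ℂ)
    {k : ℕ} (v : Fin k → Fin m) : Polynomial ℂ :=
  (Matrix.of fun a b : Fin k =>
    Polynomial.C (ξ (v a) ^ (b : ℕ)) * (s (v a)).comp (Polynomial.C (q ^ (b : ℕ)) * Polynomial.X)).det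

namespace QuantumWronskian

/-- The minor of the block matrix `(M, B; C, D)` on all rows and columns of `M`, together with
the row `r` and the column `t` of the bordering blocks. -/
def borderedMinor {n κ R : Type*} [Fintype n] [DecidableEq n] [CommRing R]
    (M : Matrix n n R) (B : Matrix n κ R) (C : Matrix κ n R) (D : Matrix κ κ R) (r t : κ) : R :=
  (fromBlocks M (B.submatrix id fun _ : Fin 1 => t) (C.submatrix (fun _ : Fin 1 => r) id)
    (D.submatrix (fun _ : Fin 1 => r) fun _ : Fin 1 => t)).det

lemma map_borderedMinor {n κ R S : Type*} [Fintype n] [DecidableEq n] [CommRing R] [CommRing S]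
    (φ : R →+* S) (M : Matrix n n R) (B : Matrix n κ R) (C : Matrix κ n R) (D : Matrix κ κ R)
    (r t : κ) :
    φ (borderedMinor M B C D r t) =
      borderedMinor (M.map φ) (B.map φ) (C.map φ) (D.map φ) r t := by
  simp only [borderedMinor, RingHom.map_det, RingHom.mapMatrix_apply, fromBlocks_map]
  rfl

lemma det_fromBlocks_mul_det_of_isUnit {n R : Type*} [Fintype n] [DecidableEq n] [CommRing R]
    (M : Matrix n n R) (B : Matrix n (Fin 2) R) (C : Matrix (Fin 2) n R)
    (D : Matrix (Fin 2) (Fin 2) R) (hM : IsUnit M.det) :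
    (fromBlocks M B C D).det * M.det =
      borderedMinor M B C D 0 0 * borderedMinor M B C D 1 1 -
        borderedMinor M B C D 0 1 * borderedMinor M B C D 1 0 := by
  have : Invertible M := M.invertibleOfIsUnitDet hM
  have h (r t : Fin 2) : borderedMinor M B C D r t = M.det * (D - C * ⅟M * B) r t := by
    rw [borderedMinor, det_fromBlocks₁₁, det_fin_one]
    simp [Matrix.mul_apply]
  rw [det_fromBlocks₁₁, det_fin_two]
  simp only [h]
  ring

lemma det_fromBlocks_mul_det_of_ne_zero {n R : Type*} [Fintype n] [DecidableEq n] [CommRing R]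
    [IsDomain R] (M : Matrix n n R) (B : Matrix n (Fin 2) R) (C : Matrix (Fin 2) n R)
    (D : Matrix (Fin 2) (Fin 2) R) (hM : M.det ≠ 0) :
    (fromBlocks M B C D).det * M.det =
      borderedMinor M B C D 0 0 * borderedMinor M B C D 1 1 -
        borderedMinor M B C D 0 1 * borderedMinor M B C D 1 0 := by
  let φ := algebraMap R (FractionRing R)
  have hφ : Function.Injective φ := IsFractionRing.injective R (FractionRing R)
  apply hφ
  have h := det_fromBlocks_mul_det_of_isUnit (M.map φ) (B.map φ) (C.map φ) (D.map φ) (by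
    rw [← RingHom.mapMatrix_apply, ← RingHom.map_det]
    exact ((map_ne_zero_iff φ hφ).2 hM).isUnit)
  simpa only [map_mul, map_sub, map_borderedMinor, RingHom.map_det, RingHom.mapMatrix_apply,
    fromBlocks_map] using h

/-- The Desnanot–Jacobi identity in block form. -/
lemma det_fromBlocks_mul_det {n R : Type*} [Fintype n] [DecidableEq n] [CommRing R]
    [IsDomain R] (M : Matrix n n R) (B : Matrix n (Fin 2) R) (C : Matrix (Fin 2) n R)
    (D : Matrix (Fin 2) (Fin 2) R) :
    (fromBlocks M B C D).det * M.det =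
      borderedMinor M B C D 0 0 * borderedMinor M B C D 1 1 -
        borderedMinor M B C D 0 1 * borderedMinor M B C D 1 0 := by
  let ε : R[X] →+* R := Polynomial.evalRingHom 0
  have hM : (charmatrix (-M)).map ε = M := by
    ext i j
    by_cases hij : i = j
    · subst hij
      simp [ε]
    · simp [ε, hij]
  have h := congrArg ε <| det_fromBlocks_mul_det_of_ne_zero (charmatrix (-M))
    (B.map Polynomial.C) (C.map Polynomial.C) (D.map Polynomial.C) (charpoly_monic (-M)).ne_zero
  have hB : (B.map Polynomial.C).map ε = B := by ext; simp [ε]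
  have hC : (C.map Polynomial.C).map ε = C := by ext; simp [ε]
  have hD : (D.map Polynomial.C).map ε = D := by ext; simp [ε]
  simpa only [map_mul, map_sub, map_borderedMinor, RingHom.map_det, RingHom.mapMatrix_apply,
    fromBlocks_map, hB, hC, hD, hM] using h

/-- The determinant with entries `x_{v i}^j f_{v i}(j + p)`. -/
def shiftedDet {I R : Type*} [CommRing R] (x : I → R) (f : I → ℕ → R) (p : ℕ) {k : ℕ}
    (v : Fin k → I) : R :=
  (of fun i j : Fin k => x (v i) ^ (j : ℕ) * f (v i) (j + p)).det

lemma coe_cycleRange_apply {n : ℕ} (i j : Fin n) :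
    (i.cycleRange j : ℕ) =
      if (j : ℕ) < i then (j : ℕ) + 1 else if (j : ℕ) = i then 0 else (j : ℕ) := by
  have : NeZero n := ⟨fun h => by subst h; exact i.elim0⟩
  split_ifs with h₁ h₂
  · exact Fin.coe_cycleRange_of_lt h₁
  · rw [Fin.cycleRange_of_eq (Fin.ext h₂), Fin.val_zero]
  · rw [Fin.cycleRange_of_gt (Fin.lt_def.2 (by omega))]

/-- The Desnanot–Jacobi identity for the minors of consecutive columns. -/
lemma desnanot_jacobi {I R : Type*} [CommRing R] [IsDomain R] (f : I → ℕ → R) {c : ℕ}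
    (v : Fin c → I) (a b : I) :
    shiftedDet 1 f 0 (Fin.snoc v a : Fin (c + 1) → I) *
        shiftedDet 1 f 1 (Fin.snoc v b : Fin (c + 1) → I) -
      shiftedDet 1 f 1 (Fin.snoc v a : Fin (c + 1) → I) *
        shiftedDet 1 f 0 (Fin.snoc v b : Fin (c + 1) → I) =
    shiftedDet 1 f 0 (Fin.snoc (Fin.snoc v a : Fin (c + 1) → I) b : Fin (c + 2) → I) *
      shiftedDet 1 f 1 v := by
  let M : Matrix (Fin c) (Fin c) R := of fun i j => f (v i) (j + 1)
  let B : Matrix (Fin c) (Fin 2) R := of fun i t => f (v i) (![0, c + 1] t)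
  let C : Matrix (Fin 2) (Fin c) R := of fun r j => f (![a, b] r) (j + 1)
  let D : Matrix (Fin 2) (Fin 2) R := of fun r t => f (![a, b] r) (![0, c + 1] t)
  have hM : shiftedDet 1 f 1 v = M.det := by simp [shiftedDet, M]
  have h₁ (r : Fin 2) : shiftedDet 1 f 1 (Fin.snoc v (![a, b] r) : Fin (c + 1) → I) =
      borderedMinor M B C D r 1 := by
    rw [shiftedDet, borderedMinor, ← det_submatrix_equiv_self finSumFinEquiv]
    congr 1
    ext (i | i) (j | j) <;> simp [M, B, C, D, Fin.snoc]
  have h₀ (r : Fin 2) : shiftedDet 1 f 0 (Fin.snoc v (![a, b] r) : Fin (c + 1) → I) =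
      (-1) ^ c * borderedMinor M B C D r 0 := by
    have hs := det_permute' (Fin.last c).cycleRange
      (of fun i j : Fin (c + 1) => f ((Fin.snoc v (![a, b] r) : Fin (c + 1) → I) i) j)
    have hb : borderedMinor M B C D r 0 =
        ((of fun i j : Fin (c + 1) => f ((Fin.snoc v (![a, b] r) : Fin (c + 1) → I) i) j).submatrix
          id (Fin.last c).cycleRange).det := by
      rw [borderedMinor, ← det_submatrix_equiv_self finSumFinEquiv (Matrix.submatrix _ _ _)]
      congr 1
      ext (i | i) (j | j) <;>
        simp [M, B, C, D, Fin.snoc, coe_cycleRange_apply, -Fin.cycleRange_last]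
    rw [hb, hs, Fin.sign_cycleRange, ← mul_assoc]
    simp [shiftedDet, ← mul_pow]
  have hF : shiftedDet 1 f 0 (Fin.snoc (Fin.snoc v a : Fin (c + 1) → I) b : Fin (c + 2) → I) =
      (-1) ^ c * (fromBlocks M B C D).det := by
    let A : Matrix (Fin (c + 2)) (Fin (c + 2)) R := of fun i j =>
      f ((Fin.snoc (Fin.snoc v a : Fin (c + 1) → I) b : Fin (c + 2) → I) i) j
    have hs := det_permute' (Fin.last c).castSucc.cycleRange A
    have hb : (fromBlocks M B C D).det =
        (A.submatrix id (Fin.last c).castSucc.cycleRange).det := by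
      rw [← det_submatrix_equiv_self finSumFinEquiv (Matrix.submatrix _ _ _)]
      congr 1
      ext (i | i) (j | j) <;> (try fin_cases i) <;> (try fin_cases j) <;>
        simp [A, M, B, C, D, Fin.snoc, coe_cycleRange_apply] <;> rfl
    rw [hb, hs, Fin.sign_cycleRange, ← mul_assoc]
    simp [shiftedDet, A, ← mul_pow]
  have h := det_fromBlocks_mul_det M B C D
  have h₁a := h₁ 0
  have h₁b := h₁ 1
  have h₀a := h₀ 0
  have h₀b := h₀ 1
  simp only [Matrix.cons_val_zero, Matrix.cons_val_one] at h₁a h₁b h₀a h₀b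
  rw [h₁a, h₁b, h₀a, h₀b, hF, hM]
  linear_combination -(-1) ^ c * h

lemma map_shiftedDet {I R S : Type*} [CommRing R] [CommRing S] (φ : R →+* S) (x : I → R)
    (f : I → ℕ → R) (p : ℕ) {k : ℕ} (v : Fin k → I) :
    φ (shiftedDet x f p v) = shiftedDet (φ ∘ x) (fun i j => φ (f i j)) p v := by
  rw [shiftedDet, shiftedDet, RingHom.map_det]
  congr 1
  ext i j
  simp

lemma shiftedDet_one_zero {I R : Type*} [CommRing R] (x : I → R) (f : I → ℕ → R) {k : ℕ}
    (v : Fin k → I) :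
    shiftedDet 1 (fun i j => x i ^ j * f i j) 0 v = shiftedDet x f 0 v := by
  simp [shiftedDet]

lemma shiftedDet_one_one {I R : Type*} [CommRing R] (x : I → R) (f : I → ℕ → R) {k : ℕ}
    (v : Fin k → I) :
    shiftedDet 1 (fun i j => x i ^ j * f i j) 1 v = (∏ i, x (v i)) * shiftedDet x f 1 v := by
  rw [shiftedDet, shiftedDet, ← det_mul_column]
  congr 1
  ext i j
  simp [pow_succ', mul_assoc]

lemma shiftedDet_QQ_of_ne_zero {I R : Type*} [CommRing R] [IsDomain R] (x : I → R)
    (f : I → ℕ → R) {c : ℕ} (v : Fin c → I) (a b : I) (hx : ∀ i, x i ≠ 0) :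
    x b * shiftedDet x f 0 (Fin.snoc v a : Fin (c + 1) → I) *
        shiftedDet x f 1 (Fin.snoc v b : Fin (c + 1) → I) -
      x a * shiftedDet x f 1 (Fin.snoc v a : Fin (c + 1) → I) *
        shiftedDet x f 0 (Fin.snoc v b : Fin (c + 1) → I) =
    shiftedDet x f 0 (Fin.snoc (Fin.snoc v a : Fin (c + 1) → I) b : Fin (c + 2) → I) *
      shiftedDet x f 1 v := by
  have h := desnanot_jacobi (fun i j => x i ^ j * f i j) v a b
  simp only [shiftedDet_one_zero, shiftedDet_one_one, Fin.prod_univ_castSucc, Fin.snoc_castSucc,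
    Fin.snoc_last] at h
  apply mul_left_cancel₀ (Finset.prod_ne_zero_iff.2 fun i _ => hx (v i) : ∏ i, x (v i) ≠ 0)
  linear_combination h

lemma shiftedDet_QQ {I R : Type*} [CommRing R] [IsDomain R] (x : I → R)
    (f : I → ℕ → R) {c : ℕ} (v : Fin c → I) (a b : I) :
    x b * shiftedDet x f 0 (Fin.snoc v a : Fin (c + 1) → I) *
        shiftedDet x f 1 (Fin.snoc v b : Fin (c + 1) → I) -
      x a * shiftedDet x f 1 (Fin.snoc v a : Fin (c + 1) → I) *
        shiftedDet x f 0 (Fin.snoc v b : Fin (c + 1) → I) =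
    shiftedDet x f 0 (Fin.snoc (Fin.snoc v a : Fin (c + 1) → I) b : Fin (c + 2) → I) *
      shiftedDet x f 1 v := by
  have h := congrArg (Polynomial.evalRingHom (0 : R)) <|
    shiftedDet_QQ_of_ne_zero (fun i => Polynomial.X + Polynomial.C (x i))
      (fun i j => Polynomial.C (f i j)) v a b fun i => Polynomial.X_add_C_ne_zero (x i)
  simp only [map_mul, map_sub, map_shiftedDet] at h
  simpa [Function.comp_def] using h

end QuantumWronskian

/-- the Desnanot–Jacobi (QQ-type) identity for quantum Wronskians: for indices
`i_1 < … < i_{j−1} < a < b`,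
`ξ_b · D_{…,a}(z) · D_{…,b}(qz) − ξ_a · D_{…,a}(qz) · D_{…,b}(z) = D_{…,a,b}(z) · D_{…}(qz)`
as an identity of polynomials in `z`.  Here `D(qz)` is the composition of `D` with `q·z`. -/
theorem qWronsk_QQ_identity (m : ℕ) (q : ℂ) (hq : q ≠ 0)
    (ξ : Fin m → ℂ) (s : Fin m → Polynomial ℂ)
    (c : ℕ) (ι : Fin c → Fin m) (hι : StrictMono ι)
    (a b : Fin m) (hab : a < b) (hlt : ∀ t, ι t < a) :
    Polynomial.C (ξ b) * qWronsk q ξ s (Fin.snoc ι a) *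
        (qWronsk q ξ s (Fin.snoc ι b)).comp (Polynomial.C q * Polynomial.X)
      - Polynomial.C (ξ a) *
        (qWronsk q ξ s (Fin.snoc ι a)).comp (Polynomial.C q * Polynomial.X) *
        qWronsk q ξ s (Fin.snoc ι b)
    = qWronsk q ξ s (Fin.snoc (Fin.snoc ι a) b) *
        (qWronsk q ξ s ι).comp (Polynomial.C q * Polynomial.X) := by
  have h₀ {k : ℕ} (v : Fin k → Fin m) : qWronsk q ξ s v =
      QuantumWronskian.shiftedDet (fun i => Polynomial.C (ξ i))
        (fun i j => (s i).comp (Polynomial.C (q ^ j) * Polynomial.X)) 0 v := by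
    simp [qWronsk, QuantumWronskian.shiftedDet]
  have h₁ {k : ℕ} (v : Fin k → Fin m) :
      (qWronsk q ξ s v).comp (Polynomial.C q * Polynomial.X) =
      QuantumWronskian.shiftedDet (fun i => Polynomial.C (ξ i))
        (fun i j => (s i).comp (Polynomial.C (q ^ j) * Polynomial.X)) 1 v := by
    rw [← Polynomial.coe_compRingHom_apply, qWronsk, RingHom.map_det, QuantumWronskian.shiftedDet]
    congr 1
    ext1 i j
    simp [Polynomial.comp_assoc, pow_succ, mul_assoc]
  simp only [h₁]
  simp only [h₀]
  exact QuantumWronskian.shiftedDet_QQ (fun i => Polynomial.C (ξ i)) _ ι a b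
end

section
/- Fix q ∈ ℂ^×, n ≥ 2, and nonzero complex numbers ξ_1,…,ξ_n. Let (Q_i^+, Q_i^−, Λ_i)_{i=1,…,n−1} be a solution of the SL(n) QQ-system. Fix i and let s ∈ ℂ be a root of Q_i^+ such that Q_i^−(s) ≠ 0. Then the Bethe ansatz equation holds at s in the product form: ξ_{i+1} · Q_i^+(qs) · Λ_i(q^{−1}s) · Q_{i−1}^+(s) · Q_{i+1}^+(q^{−1}s) = −ξ_i · Q_i^+(q^{−1}s) · Λ_i(s) · Q_{i−1}^+(qs) · Q_{i+1}^+(s). -/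
open Polynomial

/-- The `SL(n)` QQ-system for polynomials `Q_i^+, Q_i^−, Λ_i` (`i = 1,…,n−1`), with the
convention `Q_0^+ = Q_n^+ = 1`: for all `i = 1,…,n−1` and all `z`,
`ξ_{i+1} Q_i^+(qz) Q_i^−(z) − ξ_i Q_i^+(z) Q_i^−(qz)
  = (ξ_{i+1} − ξ_i) Λ_i(z) Q_{i−1}^+(qz) Q_{i+1}^+(z)`. -/
def IsQQSystem (n : ℕ) (q : ℂ) (ξ : ℕ → ℂ) (Qp Qm Λ : ℕ → Polynomial ℂ) : Prop :=
  Qp 0 = 1 ∧ Qp n = 1 ∧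
  ∀ i, 1 ≤ i → i ≤ n - 1 → ∀ z : ℂ,
    ξ (i + 1) * (Qp i).eval (q * z) * (Qm i).eval z
      - ξ i * (Qp i).eval z * (Qm i).eval (q * z)
    = (ξ (i + 1) - ξ i) * (Λ i).eval z * (Qp (i - 1)).eval (q * z) * (Qp (i + 1)).eval z

/-- if `(Q_i^+, Q_i^−, Λ_i)` is a solution of the `SL(n)` QQ-system and `s` is a
root of `Q_i^+` with `Q_i^−(s) ≠ 0`, then the Bethe ansatz equation holds at `s` in the product
form `ξ_{i+1} Q_i^+(qs) Λ_i(q⁻¹s) Q_{i−1}^+(s) Q_{i+1}^+(q⁻¹s)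
  = −ξ_i Q_i^+(q⁻¹s) Λ_i(s) Q_{i−1}^+(qs) Q_{i+1}^+(s)`. -/
theorem bethe_from_QQ (n : ℕ) (hn : 2 ≤ n) (q : ℂ) (hq : q ≠ 0)
    (ξ : ℕ → ℂ) (hξ : ∀ i, 1 ≤ i → i ≤ n → ξ i ≠ 0)
    (Qp Qm Λ : ℕ → Polynomial ℂ) (hQQ : IsQQSystem n q ξ Qp Qm Λ)
    (i : ℕ) (hi1 : 1 ≤ i) (hi2 : i ≤ n - 1)
    (s : ℂ) (hs : (Qp i).eval s = 0) (hQm : (Qm i).eval s ≠ 0) :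
    ξ (i + 1) * (Qp i).eval (q * s) * (Λ i).eval (q⁻¹ * s) *
        (Qp (i - 1)).eval s * (Qp (i + 1)).eval (q⁻¹ * s)
      = -ξ i * (Qp i).eval (q⁻¹ * s) * (Λ i).eval s *
        (Qp (i - 1)).eval (q * s) * (Qp (i + 1)).eval s := by
  obtain ⟨-, -, h⟩ := hQQ
  have h_root := h i hi1 hi2 s
  have h_shift := h i hi1 hi2 (q⁻¹ * s)
  rw [mul_inv_cancel_left₀ hq] at h_shift
  rw [hs] at h_root h_shift
  apply mul_right_cancel₀ hQm
  linear_combination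
    (Λ i).eval (q⁻¹ * s) * (Qp (i - 1)).eval s * (Qp (i + 1)).eval (q⁻¹ * s) * h_root
      - (Λ i).eval s * (Qp (i - 1)).eval (q * s) * (Qp (i + 1)).eval s * h_shift
end

section
/- Fix q ∈ ℂ^× not a root of unity, n ≥ 2, and nonzero complex numbers ξ_1,…,ξ_n such that ξ_i/ξ_{i+1} ∉ q^ℤ for each i = 1,…,n−1. Let Q_1^+,…,Q_{n−1}^+ and Λ_1,…,Λ_{n−1} be polynomials in ℂ[z] (with the convention Q_0^+ = Q_n^+ = 1) such that for every i, every root s of Q_i^+ is nonzero and simple, satisfies Q_i^+(qs) ≠ 0, Q_i^+(q^{−1}s) ≠ 0 and Λ_i(q^{−1}s) · Q_{i−1}^+(s) · Q_{i+1}^+(q^{−1}s) ≠ 0, and satisfies the Bethe ansatz equation ξ_{i+1} · Q_i^+(qs) · Λ_i(q^{−1}s) · Q_{i−1}^+(s) · Q_{i+1}^+(q^{−1}s) = −ξ_i · Q_i^+(q^{−1}s) · Λ_i(s) · Q_{i−1}^+(qs) · Q_{i+1}^+(s). Then there exist polynomials Q_1^−,…,Q_{n−1}^− ∈ ℂ[z]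 such that (Q_i^+, Q_i^−, Λ_i)_{i=1,…,n−1} is a solution of the SL(n) QQ-system. -/
open Polynomial

/-- The twisted difference equation `a W(z) - b W(qz) = U(z)` has a polynomial solution as soon as
`a ≠ b q ^ k` for every `k`. -/
theorem exists_twisted_difference_eq {K : Type*} [Field K] {a b q : K}
    (h : ∀ k : ℕ, a - b * q ^ k ≠ 0) (U : K[X]) :
    ∃ W : K[X], ∀ z, a * W.eval z - b * W.eval (q * z) = U.eval z := by
  induction U using Polynomial.induction_on' with
  | add U V hU hV =>
    obtain ⟨W, hW⟩ := hU
    obtain ⟨Y, hY⟩ := hV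
    refine ⟨W + Y, fun z => ?_⟩
    rw [eval_add, eval_add, eval_add, ← hW, ← hY]
    ring
  | monomial k c =>
    refine ⟨monomial k (c / (a - b * q ^ k)), fun z => ?_⟩
    have hk := h k
    simp only [eval_monomial, mul_pow]
    field_simp

/-- A polynomial with only simple roots divides every polynomial vanishing at these roots. -/
theorem dvd_of_forall_root_of_rootMultiplicity_eq_one {K : Type*} [Field K] [IsAlgClosed K]
    {P D : K[X]} (hP : P ≠ 0) (hsimple : ∀ s, P.eval s = 0 → P.rootMultiplicity s = 1)
    (hD : ∀ s, P.eval s = 0 → D.eval s = 0) : P ∣ D := by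
  classical
  rcases eq_or_ne D 0 with rfl | hD0
  · exact dvd_zero P
  rw [(IsAlgClosed.splits P).dvd_iff_roots_le_roots hP hD0, Multiset.le_iff_subset]
  · intro s hs
    exact (mem_roots hD0).2 (hD s ((mem_roots hP).1 hs))
  · rw [Multiset.nodup_iff_count_eq_one]
    intro s hs
    rw [count_roots]
    exact hsimple s ((mem_roots hP).1 hs)

/-- A single QQ-relation with prescribed right-hand side `(a - b) R` is solvable when the Bethe
equations hold at the roots of `P`. -/
theorem exists_QQ_relation_of_bethe {K : Type*} [Field K] [IsAlgClosed K] {a b q : K}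
    (hq : q ≠ 0) (ha : a ≠ 0) (h : ∀ k : ℕ, a - b * q ^ k ≠ 0) {P : K[X]} (hP : P ≠ 0) (R : K[X])
    (hsimple : ∀ s, P.eval s = 0 → P.rootMultiplicity s = 1)
    (hshift : ∀ s, P.eval s = 0 → P.eval (q * s) ≠ 0)
    (hbethe : ∀ s, P.eval s = 0 →
      a * P.eval (q * s) * R.eval (q⁻¹ * s) = -b * P.eval (q⁻¹ * s) * R.eval s) :
    ∃ M : K[X], ∀ z, a * P.eval (q * z) * M.eval z - b * P.eval z * M.eval (q * z)
      = (a - b) * R.eval z := by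
  classical
  obtain ⟨N, hN⟩ : ∃ N : K[X], ∀ s, P.eval s = 0 →
      a * P.eval (q * s) * N.eval s = (a - b) * R.eval s := by
    refine ⟨Lagrange.interpolate P.roots.toFinset id
      fun s => (a - b) * R.eval s / (a * P.eval (q * s)), fun s hs => ?_⟩
    have hs' : s ∈ P.roots.toFinset := Multiset.mem_toFinset.2 ((mem_roots hP).2 hs)
    have he := Lagrange.eval_interpolate_at_node
      (fun s => (a - b) * R.eval s / (a * P.eval (q * s))) (Set.injOn_id _) hs'
    rw [id_eq] at he
    rw [he]
    exact mul_div_cancel₀ _ (mul_ne_zero ha (hshift s hs))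
  let P' : K[X] := P.comp (C q * X)
  let D : K[X] := C a * P' * N - C b * P * N.comp (C q * X) - C (a - b) * R
  have hDeval (z : K) : D.eval z =
      a * P.eval (q * z) * N.eval z - b * P.eval z * N.eval (q * z) - (a - b) * R.eval z := by
    simp [D, P']
  have hPD : P ∣ D := by
    refine dvd_of_forall_root_of_rootMultiplicity_eq_one hP hsimple fun s hs => ?_
    rw [hDeval, hN s hs, hs]
    ring
  have hP'D : P' ∣ D := by
    have hdvd : P ∣ D.comp (C q⁻¹ * X) := by
      refine dvd_of_forall_root_of_rootMultiplicity_eq_one hP hsimple fun s hs => ?_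
      simp only [eval_comp, eval_mul, eval_C, eval_X, hDeval, mul_inv_cancel_left₀ hq, hs]
      refine (mul_eq_zero.1 ?_).resolve_left (mul_ne_zero ha (hshift s hs))
      linear_combination -b * P.eval (q⁻¹ * s) * hN s hs - (a - b) * hbethe s hs
    obtain ⟨V, hV⟩ := hdvd
    refine ⟨V.comp (C q * X), ?_⟩
    rw [← mul_comp, ← hV, comp_assoc]
    simp [← mul_assoc, ← C_mul, inv_mul_cancel₀ hq]
  have hcop : IsCoprime P P' := by
    rw [isCoprime_iff_aeval_ne_zero_of_isAlgClosed K K]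
    intro s
    by_cases hs : P.eval s = 0
    · right
      simpa [P', coe_aeval_eq_eval] using hshift s hs
    · left
      simpa [coe_aeval_eq_eval] using hs
  obtain ⟨U, hU⟩ := hcop.mul_dvd hPD hP'D
  obtain ⟨W, hW⟩ := exists_twisted_difference_eq h U
  refine ⟨N - P * W, fun z => ?_⟩
  have hUz := congrArg (eval z) hU
  rw [hDeval] at hUz
  simp only [P', eval_mul, eval_comp, eval_C, eval_X] at hUz
  simp only [eval_sub, eval_mul]
  linear_combination hUz - P.eval z * P.eval (q * z) * hW z

/-- if `q` is not a root of unity, `ξ_i/ξ_{i+1} ∉ q^ℤ`, and the polynomials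
`Q_1^+,…,Q_{n−1}^+` (with `Q_0^+ = Q_n^+ = 1`) have only nonzero simple roots, nondegenerate in
the stated sense, satisfying the Bethe ansatz equations, then there exist polynomials
`Q_1^−,…,Q_{n−1}^−` completing them to a solution of the `SL(n)` QQ-system. -/
theorem QQ_from_bethe (n : ℕ) (hn : 2 ≤ n) (q : ℂ) (hq : q ≠ 0)
    (hqru : ∀ k : ℕ, 0 < k → q ^ k ≠ 1)
    (ξ : ℕ → ℂ) (hξ : ∀ i, 1 ≤ i → i ≤ n → ξ i ≠ 0)
    (hratio : ∀ i, 1 ≤ i → i ≤ n - 1 → ∀ m : ℤ, ξ i / ξ (i + 1) ≠ q ^ m)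
    (Qp Λ : ℕ → Polynomial ℂ) (hQ0 : Qp 0 = 1) (hQn : Qp n = 1)
    (hroots : ∀ i, 1 ≤ i → i ≤ n - 1 → ∀ s : ℂ, (Qp i).eval s = 0 →
      s ≠ 0 ∧
      (Qp i).rootMultiplicity s = 1 ∧
      (Qp i).eval (q * s) ≠ 0 ∧
      (Qp i).eval (q⁻¹ * s) ≠ 0 ∧
      (Λ i).eval (q⁻¹ * s) * (Qp (i - 1)).eval s * (Qp (i + 1)).eval (q⁻¹ * s) ≠ 0 ∧
      ξ (i + 1) * (Qp i).eval (q * s) * (Λ i).eval (q⁻¹ * s) *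
          (Qp (i - 1)).eval s * (Qp (i + 1)).eval (q⁻¹ * s)
        = -ξ i * (Qp i).eval (q⁻¹ * s) * (Λ i).eval s *
          (Qp (i - 1)).eval (q * s) * (Qp (i + 1)).eval s) :
    ∃ Qm : ℕ → Polynomial ℂ, IsQQSystem n q ξ Qp Qm Λ := by
  have hrel (i : ℕ) : ∃ M : ℂ[X], 1 ≤ i → i ≤ n - 1 → ∀ z : ℂ,
      ξ (i + 1) * (Qp i).eval (q * z) * M.eval z - ξ i * (Qp i).eval z * M.eval (q * z)
        = (ξ (i + 1) - ξ i) * (Λ i).eval z * (Qp (i - 1)).eval (q * z) * (Qp (i + 1)).eval z := by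
    by_cases hi : 1 ≤ i ∧ i ≤ n - 1
    swap
    · exact ⟨0, fun h₁ h₂ => absurd ⟨h₁, h₂⟩ hi⟩
    obtain ⟨h₁, h₂⟩ := hi
    have hr := hroots i h₁ h₂
    have ha : ξ (i + 1) ≠ 0 := hξ (i + 1) (by omega) (by omega)
    have hP : Qp i ≠ 0 := fun h => (hr 0 (by simp [h])).1 rfl
    have hne (k : ℕ) : ξ (i + 1) - ξ i * q ^ k ≠ 0 := by
      intro hk
      apply hratio i h₁ h₂ (-(k : ℤ))
      rw [zpow_neg, zpow_natCast, div_eq_iff ha, sub_eq_zero.1 hk]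
      have := pow_ne_zero k hq
      field_simp
    obtain ⟨M, hM⟩ := exists_QQ_relation_of_bethe hq ha hne hP
      (Λ i * (Qp (i - 1)).comp (C q * X) * Qp (i + 1))
      (fun s hs => (hr s hs).2.1) (fun s hs => (hr s hs).2.2.1) (fun s hs => by
        simp only [eval_mul, eval_comp, eval_C, eval_X, mul_inv_cancel_left₀ hq]
        linear_combination (hr s hs).2.2.2.2.2)
    refine ⟨M, fun _ _ z => ?_⟩
    rw [hM z]
    simp only [eval_mul, eval_comp, eval_C, eval_X]
    ring
  choose Qm hQm using hrel
  exact ⟨Qm, hQ0, hQn, hQm⟩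
end

section
/- Fix q ∈ ℂ^×, n ≥ 2, and nonzero complex numbers ξ_i, ξ_{i+1} with ξ_{i+1}/ξ_i ∉ q^ℤ. Let Q^+ ∈ ℂ[z] be a nonzero polynomial and R ∈ ℂ[z] a polynomial satisfying the homogeneous relation ξ_{i+1} Q^+(qz) R(z) − ξ_i Q^+(z) R(qz) = 0 for all z. Then R = 0. Consequently, for fixed data (Q_i^+, Λ_i, Q_{i−1}^+, Q_{i+1}^+) and such ξ_i, ξ_{i+1}, a polynomial Q_i^− satisfying the i-th QQ-system relation ξ_{i+1} Q_i^+(qz) Q_i^−(z) − ξ_i Q_i^+(z) Q_i^−(qz) = (ξ_{i+1} − ξ_i) Λ_i(z) Q_{i−1}^+(qz) Q_{i+1}^+(z) is unique if it exists. -/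
open Polynomial

/-- If `P(qz) R(z)` and `P(z) R(qz)` are proportional polynomials, with ratio outside `q^ℤ`,
then `R = 0`: compare leading coefficients. -/
theorem eq_zero_of_qdiff_homogeneous {K : Type*} [Field K] [Infinite K] {q a b : K} (hq : q ≠ 0)
    (ha : a ≠ 0) (hab : ∀ m : ℤ, b / a ≠ q ^ m) {P R : K[X]} (hP : P ≠ 0)
    (h : ∀ z : K, b * P.eval (q * z) * R.eval z - a * P.eval z * R.eval (q * z) = 0) :
    R = 0 := by
  by_contra hR
  have hlin : (C q * X : K[X]).natDegree ≠ 0 := by simp [natDegree_C_mul_X q hq]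
  have hpoly : C b * P.comp (C q * X) * R = C a * P * R.comp (C q * X) := by
    refine Polynomial.funext fun z => ?_
    simpa using sub_eq_zero.mp (h z)
  have hlead := congrArg leadingCoeff hpoly
  simp only [leadingCoeff_mul, leadingCoeff_C, leadingCoeff_comp hlin, leadingCoeff_X,
    mul_one] at hlead
  have hp := leadingCoeff_ne_zero.mpr hP
  have hr := leadingCoeff_ne_zero.mpr hR
  have hpow : b * q ^ P.natDegree = a * q ^ R.natDegree :=
    mul_right_cancel₀ (mul_ne_zero hp hr) (by linear_combination hlead)
  refine hab (R.natDegree - P.natDegree) ?_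
  rw [zpow_sub₀ hq, zpow_natCast, zpow_natCast, div_eq_div_iff ha (pow_ne_zero _ hq), hpow,
    mul_comm]

/-- for `ξ_i, ξ_{i+1}` nonzero with `ξ_{i+1}/ξ_i ∉ q^ℤ`:
(a) if `Q^+ ≠ 0` and `R` satisfies the homogeneous relation
`ξ_{i+1} Q^+(qz) R(z) − ξ_i Q^+(z) R(qz) = 0` for all `z`, then `R = 0`;
(b) consequently, for fixed data `(Q_i^+, Λ_i, Q_{i−1}^+, Q_{i+1}^+)`, a polynomial `Q_i^−`
satisfying the `i`-th QQ-system relation is unique if it exists. -/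
theorem QQ_minus_unique (n : ℕ) (hn : 2 ≤ n) (q : ℂ) (hq : q ≠ 0)
    (i : ℕ) (hi1 : 1 ≤ i) (hi2 : i ≤ n - 1)
    (ξi ξi1 : ℂ) (hξi : ξi ≠ 0) (hξi1 : ξi1 ≠ 0)
    (hratio : ∀ m : ℤ, ξi1 / ξi ≠ q ^ m)
    (Qp : Polynomial ℂ) (hQp : Qp ≠ 0) :
    (∀ R : Polynomial ℂ,
        (∀ z : ℂ, ξi1 * Qp.eval (q * z) * R.eval z - ξi * Qp.eval z * R.eval (q * z) = 0) →
        R = 0) ∧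
    (∀ Λ Qpm Qpp Qm₁ Qm₂ : Polynomial ℂ,
        (∀ z : ℂ, ξi1 * Qp.eval (q * z) * Qm₁.eval z - ξi * Qp.eval z * Qm₁.eval (q * z)
          = (ξi1 - ξi) * Λ.eval z * Qpm.eval (q * z) * Qpp.eval z) →
        (∀ z : ℂ, ξi1 * Qp.eval (q * z) * Qm₂.eval z - ξi * Qp.eval z * Qm₂.eval (q * z)
          = (ξi1 - ξi) * Λ.eval z * Qpm.eval (q * z) * Qpp.eval z) →
        Qm₁ = Qm₂) := by
  refine ⟨fun R h => eq_zero_of_qdiff_homogeneous hq hξi hratio hQp h,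
    fun Λ Qpm Qpp Qm₁ Qm₂ h₁ h₂ => sub_eq_zero.mp ?_⟩
  refine eq_zero_of_qdiff_homogeneous hq hξi hratio hQp fun z => ?_
  simp only [eval_sub]
  linear_combination h₁ z - h₂ z
end
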